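/- The smallest number of conjugacy classes of a finite group of order 930 = 2·3·5·31 is 24; that is, every group of order 930 has at least 24 conjugacy classes and some group of order 930 has exactly 24 conjugacy classes. -/

import Mathlib

open Finset in
/-- If every class meeting `s` has size at most `b`, then `s` meets at least `#s / b` classes. -/
lemma card_le_mul_classes {G : Type} [Group G] [Fintype G] [DecidableEq G]
    [DecidableEq (ConjClasses G)] (s : Finset G) (b : ℕ)
    (h : ∀ g ∈ s, Nat.card (ConjClasses.mk g).carrier ≤ b) :
    #s ≤ b * #(s.image ConjClasses.mk) := by
  classical
  apply Finset.card_le_mul_card_image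
  intro c hc
  obtain ⟨g, hg, rfl⟩ := Finset.mem_image.1 hc
  refine le_trans ?_ (h g hg)
  rw [Nat.card_eq_fintype_card, ← Set.toFinset_card]
  apply Finset.card_le_card
  intro x hx
  simp only [Finset.mem_filter] at hx
  simp [ConjClasses.mem_carrier_iff_mk_eq, hx.2]

lemma class_mul_centralizer {G : Type} [Group G] [Finite G] (g : G) :
    Nat.card (ConjClasses.mk g).carrier * Nat.card (Subgroup.centralizer {g}) = Nat.card G := by
  classical
  have := Fintype.ofFinite G
  rw [Subgroup.nat_card_centralizer_nat_card_stabilizer, ← ConjAct.orbit_eq_carrier_conjClasses]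
  have := MulAction.card_orbit_mul_card_stabilizer_eq_card_group (ConjAct G) g
  simp only [Nat.card_eq_fintype_card]
  rw [this]; rfl

lemma abel_of_conj {G : Type} [Group G] {g h : G} (hc : ConjClasses.mk g = ConjClasses.mk h) :
    Abelianization.of g = Abelianization.of h := by
  rw [ConjClasses.mk_eq_mk_iff_isConj, isConj_iff] at hc
  obtain ⟨c, rfl⟩ := hc
  simp

lemma mem_comm_iff {G : Type} [Group G] {g : G} :
    Abelianization.of g = 1 ↔ g ∈ commutator G := by
  rw [← MonoidHom.mem_ker, Abelianization.ker_of]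

open Finset in
lemma sum_classes_le {G : Type} [Group G] [Fintype G] [DecidableEq G]
    [DecidableEq (ConjClasses G)] [Fintype (Abelianization G)] [DecidableEq (Abelianization G)] :
    ∑ q : Abelianization G,
      #((univ.filter (fun g : G => Abelianization.of g = q)).image ConjClasses.mk)
      ≤ Nat.card (ConjClasses G) := by
  classical
  have := Fintype.ofFinite (ConjClasses G)
  rw [← Finset.card_biUnion, Nat.card_eq_fintype_card]
  · exact Finset.card_le_univ _
  · intro q _ r _ hqr
    rw [Function.onFun, Finset.disjoint_left]
    intro c hc hc'
    simp only [mem_image, mem_filter, mem_univ, true_and] at hc hc'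
    obtain ⟨g, rfl, rfl⟩ := hc
    obtain ⟨h, rfl, hh⟩ := hc'
    exact hqr (abel_of_conj hh.symm)

open Finset in
lemma card_fib {G : Type} [Group G] [Fintype G] [DecidableEq G]
    [DecidableEq (Abelianization G)] (q : Abelianization G) :
    #(univ.filter (fun g : G => Abelianization.of g = q)) = Nat.card (commutator G) := by
  have hs : ∀ x : Abelianization G, x ∈ Set.range (Abelianization.of (G := G)) :=
    fun x => QuotientGroup.mk_surjective x
  rw [MonoidHom.card_fiber_eq_of_mem_range (Abelianization.of (G := G)) (hs q) (hs 1)]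
  rw [← Fintype.card_subtype, ← Nat.card_eq_fintype_card]
  exact Nat.card_congr (Equiv.subtypeEquivRight fun g => mem_comm_iff)

lemma squarefree_930 : Squarefree 930 := by
  rw [Nat.squarefree_iff_minSqFac]; decide +kernel

lemma card_comm_dvd {G : Type} [Group G] [Finite G] (hG : Nat.card G = 930) :
    Nat.card (commutator G) ∣ 465 := by
  have hZ : IsZGroup G := IsZGroup.of_squarefree (by
    rw [hG]; exact squarefree_930)
  have : Fact (Nat.Prime 2) := ⟨Nat.prime_two⟩
  obtain ⟨P⟩ : Nonempty (Sylow 2 G) := inferInstance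
  have hP : IsCyclic P := inferInstance
  have hmin : (Nat.card G).minFac = 2 := by rw [hG]; norm_num
  have hc := IsCyclic.isComplement' hmin hP
  set K := (MonoidHom.transferSylow P (hP.normalizer_le_centralizer hmin)).ker
  have h2 : Nat.card P = 2 := by
    rw [P.card_eq_multiplicity, hG]
    have : Nat.factorization 930 2 = 1 := by
      rw [show 930 = 2 ^ 1 * 465 by norm_num, Nat.factorization_mul (by norm_num) (by norm_num),
        Nat.Prime.factorization_pow Nat.prime_two, Finsupp.add_apply,
        Nat.factorization_eq_zero_of_not_dvd (n := 465) (by norm_num)]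
      simp
    rw [this]; norm_num
  have hidx : K.index = 2 := by rw [hc.symm.index_eq_card]; exact h2
  have hK : Nat.card K = 465 := by
    have := K.card_mul_index
    rw [hidx, hG] at this; omega
  rw [← hK]
  apply Subgroup.card_dvd_of_le
  rw [commutator_def, Subgroup.commutator_le]
  intro a _ b _
  rw [commutatorElement_def]
  simp only [Subgroup.mul_mem_iff_of_index_two hidx, inv_mem_iff]
  tauto

lemma class_le_card_comm {G : Type} [Group G] [Finite G] (g : G) :
    Nat.card (ConjClasses.mk g).carrier ≤ Nat.card (commutator G) := by
  have hf : ∀ x : (ConjClasses.mk g).carrier, (x : G) * g⁻¹ ∈ commutator G := by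
    rintro ⟨x, hx⟩
    rw [ConjClasses.mem_carrier_iff_mk_eq] at hx
    rw [← mem_comm_iff, map_mul, map_inv, abel_of_conj hx]; simp
  apply Nat.card_le_card_of_injective (fun x : (ConjClasses.mk g).carrier => (⟨(x : G) * g⁻¹, hf x⟩ : commutator G))
  intro x y h
  simp only [Subtype.mk.injEq, mul_left_inj] at h
  exact Subtype.ext h

lemma class_le_of_mem_comm {G : Type} [Group G] [Finite G] (hc : IsCyclic (commutator G))
    (n m : ℕ) (hn : Nat.card (commutator G) = n) (hnm : Nat.card G = n * m)
    (g : G) (hg : g ∈ commutator G) :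
    Nat.card (ConjClasses.mk g).carrier ≤ m := by
  have h1 := class_mul_centralizer g
  have hle : commutator G ≤ Subgroup.centralizer {g} := by
    intro x hx
    rw [Subgroup.mem_centralizer_singleton_iff]
    have : IsMulCommutative (commutator G) := IsCyclic.isMulCommutative
    exact congrArg Subtype.val (this.is_comm.comm ⟨x, hx⟩ ⟨g, hg⟩)
  have h2 := Subgroup.card_le_of_le hle
  have hpos : 0 < n := hn ▸ Nat.card_pos
  rw [hn] at h2
  by_contra! hlt
  have : n * m < Nat.card (ConjClasses.mk g).carrier * Nat.card (Subgroup.centralizer {g}) := by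
    calc n * m < n * Nat.card (ConjClasses.mk g).carrier := by gcongr
      _ ≤ _ := by rw [mul_comm]; gcongr
  omega

open Finset in
lemma lower_bound (G : Type) [Group G] [Finite G] (hG : Nat.card G = 930) :
    24 ≤ Nat.card (ConjClasses G) := by
  classical
  have := Fintype.ofFinite G
  have := Fintype.ofFinite (Abelianization G)
  have hZ : IsZGroup G := IsZGroup.of_squarefree (by
    rw [hG]; exact squarefree_930)
  have hcyc : IsCyclic (commutator G) := IsZGroup.isCyclic_commutator G
  have hdvd := card_comm_dvd hG
  obtain ⟨n, hn⟩ : ∃ n, Nat.card (commutator G) = n := ⟨_, rfl⟩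
  obtain ⟨m, hm⟩ : ∃ m, Nat.card (Abelianization G) = m := ⟨_, rfl⟩
  have hnm : Nat.card G = n * m := by
    rw [← hn, ← hm, ← (commutator G).card_mul_index]; rfl
  let F : Abelianization G → Finset G := fun q => univ.filter (fun g : G => Abelianization.of g = q)
  let N : Abelianization G → ℕ := fun q => #((F q).image ConjClasses.mk)
  have hsum : ∑ q, N q ≤ Nat.card (ConjClasses G) := sum_classes_le
  have hF : ∀ q, #(F q) = n := fun q => hn ▸ card_fib q
  have hmemF : ∀ q g, g ∈ F q ↔ Abelianization.of g = q := by simp [F]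
  have hnpos : 0 < n := hn ▸ Nat.card_pos
  have hN1 : ∀ q, 1 ≤ N q := by
    intro q
    rw [Nat.succ_le_iff, Finset.card_pos, Finset.image_nonempty, ← Finset.card_pos, hF]
    exact hnpos
  have hNone : n ≤ m * N 1 := by
    rw [← hF 1]
    apply card_le_mul_classes
    intro g hg
    exact class_le_of_mem_comm hcyc n m hn hnm g (mem_comm_iff.1 ((hmemF _ _).1 hg))
  have hmc : #(univ : Finset (Abelianization G)) = m := by
    rw [← hm, Nat.card_eq_fintype_card]; rfl
  have hsplit : N 1 + ∑ q ∈ univ.erase 1, N q = ∑ q, N q :=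
    Finset.add_sum_erase _ _ (mem_univ _)
  have hrest : m - 1 ≤ ∑ q ∈ univ.erase 1, N q := by
    calc m - 1 = ∑ q ∈ (univ : Finset (Abelianization G)).erase 1, 1 := by
          rw [Finset.sum_const, Finset.card_erase_of_mem (mem_univ _), hmc]; simp
      _ ≤ _ := Finset.sum_le_sum fun q _ => hN1 q
  rw [hn] at hdvd
  have hn' : n ∈ Nat.divisors 465 := by simp [hdvd]
  have hdiv : Nat.divisors 465 = {1, 3, 5, 15, 31, 93, 155, 465} := by decide +kernel
  rw [hdiv] at hn'
  by_cases h93 : n = 93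
  swap
  · simp only [Finset.mem_insert, Finset.mem_singleton] at hn'
    rw [hG] at hnm
    rcases hn' with rfl | rfl | rfl | rfl | rfl | rfl | rfl | rfl
    · omega
    · omega
    · omega
    · omega
    · omega
    · omega
    · obtain rfl : m = 6 := by omega
      omega
    · obtain rfl : m = 2 := by omega
      omega
  -- the main case
  subst h93
  obtain rfl : m = 10 := by omega
  have : Fact (Nat.Prime 3) := ⟨Nat.prime_three⟩
  obtain ⟨⟨a, haD⟩, ha⟩ := exists_prime_orderOf_dvd_card' (G := commutator G) 3
    (by rw [hn]; norm_num)
  rw [Subgroup.orderOf_mk] at ha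
  have ha3 : a ^ 3 = 1 := ha ▸ pow_orderOf_eq_one a
  have ha1 : a ≠ 1 := by rintro rfl; simp at ha
  let T : Finset G := (F 1).filter (fun g => g ^ 3 = 1)
  have hT : #T ≤ 3 := by
    refine le_trans ?_ (IsCyclic.card_pow_eq_one_le (α := commutator G) (n := 3) (by norm_num))
    rw [← Finset.card_map (Function.Embedding.subtype _)]
    apply Finset.card_le_card
    intro x hx
    simp only [T, mem_filter, hmemF, mem_comm_iff] at hx
    simp only [mem_map, mem_filter, mem_univ, true_and]
    exact ⟨⟨x, hx.1⟩, Subtype.ext hx.2, rfl⟩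
  have hpowconj : ∀ x y : G, ConjClasses.mk x = ConjClasses.mk y → y ^ 3 = 1 → x ^ 3 = 1 := by
    intro x y h hy
    rw [ConjClasses.mk_eq_mk_iff_isConj, isConj_comm, isConj_iff] at h
    obtain ⟨c, rfl⟩ := h
    simp [conj_pow, hy]
  have hcla : Nat.card (ConjClasses.mk a).carrier ≤ 2 := by
    have h1T : (1 : G) ∈ T := by simp [T, hmemF]
    have : #(T.erase 1) ≤ 2 := by rw [Finset.card_erase_of_mem h1T]; omega
    refine le_trans ?_ this
    rw [Nat.card_eq_fintype_card, ← Set.toFinset_card]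
    apply Finset.card_le_card
    intro x hx
    rw [Set.mem_toFinset, ConjClasses.mem_carrier_iff_mk_eq] at hx
    simp only [T, mem_erase, mem_filter, hmemF]
    refine ⟨?_, ?_, hpowconj _ _ hx ha3⟩
    · rintro rfl
      rw [ConjClasses.mk_eq_mk_iff_isConj, isConj_one_right] at hx
      exact ha1 hx
    · rw [abel_of_conj hx, mem_comm_iff]; exact haD
  have hN11 : 11 ≤ N 1 := by
    have hsd : 90 ≤ #(F 1 \ T) := by
      have := Finset.le_card_sdiff T (F 1)
      rw [hF] at this; omega
    have h9 : #(F 1 \ T) ≤ 10 * #((F 1 \ T).image ConjClasses.mk) := by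
      apply card_le_mul_classes
      intro g hg
      exact class_le_of_mem_comm hcyc 93 10 hn hnm g
        (mem_comm_iff.1 ((hmemF _ _).1 (Finset.mem_sdiff.1 hg).1))
    have hna : ∀ b : G, b ^ 3 = 1 → ConjClasses.mk b ∉ (F 1 \ T).image ConjClasses.mk := by
      intro b hb hmem
      simp only [mem_image, mem_sdiff, T, mem_filter, not_and] at hmem
      obtain ⟨x, ⟨hx1, hx2⟩, hx3⟩ := hmem
      exact hx2 hx1 (hpowconj _ _ hx3 hb)
    have hsub : insert (ConjClasses.mk 1) (insert (ConjClasses.mk a)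
        ((F 1 \ T).image ConjClasses.mk)) ⊆ (F 1).image ConjClasses.mk := by
      intro c hc
      simp only [mem_insert] at hc
      rcases hc with rfl | rfl | hc
      · exact mem_image_of_mem _ (by simp [hmemF])
      · exact mem_image_of_mem _ (by rw [hmemF, mem_comm_iff]; exact haD)
      · exact Finset.image_subset_image Finset.sdiff_subset hc
    have := Finset.card_le_card hsub
    rw [Finset.card_insert_of_notMem, Finset.card_insert_of_notMem (hna a ha3)] at this
    · change _ ≤ N 1 at this
      omega
    · rw [mem_insert, not_or]
      refine ⟨?_, hna 1 (by simp)⟩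
      rw [ConjClasses.mk_eq_mk_iff_isConj, isConj_one_right]
      exact fun h => ha1 h
  -- the image of the centralizer of `a`
  let C := Subgroup.centralizer {a}
  have hC : 465 ≤ Nat.card C := by
    have := class_mul_centralizer a
    rw [hG] at this
    change _ * Nat.card C = _ at this
    nlinarith
  let Q : Finset (Abelianization G) := univ.filter (fun q => ∃ g ∈ C, Abelianization.of g = q)
  have hQ : 5 ≤ #Q := by
    have : #(univ.filter (fun g : G => g ∈ C)) ≤ 93 * #Q := by
      apply Finset.card_le_mul_card_image_of_maps_to (f := fun g : G => Abelianization.of g)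
      · intro g hg
        simp only [mem_filter, mem_univ, true_and, Q] at hg ⊢
        exact ⟨g, hg, rfl⟩
      · intro q hq
        rw [← hF q]
        apply Finset.card_le_card
        intro g hg
        rw [mem_filter] at hg
        exact (hmemF _ _).2 hg.2
    have h2 : Nat.card C = #(univ.filter (fun g : G => g ∈ C)) := by
      rw [← Fintype.card_subtype, ← Nat.card_eq_fintype_card]
    omega
  have hDC : commutator G ≤ C := by
    intro x hx
    rw [Subgroup.mem_centralizer_singleton_iff]
    have : IsMulCommutative (commutator G) := IsCyclic.isMulCommutative
    exact congrArg Subtype.val (this.is_comm.comm ⟨x, hx⟩ ⟨a, haD⟩)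
  have hNQ : ∀ q ∈ Q, 2 ≤ N q := by
    intro q hq
    simp only [mem_filter, mem_univ, true_and, Q] at hq
    obtain ⟨g₀, hg₀, rfl⟩ := hq
    have : #(F (Abelianization.of g₀)) ≤ 62 * N (Abelianization.of g₀) := by
      apply card_le_mul_classes
      intro g hg
      rw [hmemF] at hg
      have hgC : g ∈ C := by
        have : g * g₀⁻¹ ∈ commutator G := by rw [← mem_comm_iff]; simp [hg]
        simpa using C.mul_mem (hDC this) hg₀
      have haC : a ∈ Subgroup.centralizer {g} := by
        rw [Subgroup.mem_centralizer_singleton_iff] at hgC ⊢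
        exact hgC.symm
      have h3 : 3 ∣ Nat.card (Subgroup.centralizer {g}) := by
        rw [← ha]; exact Subgroup.orderOf_dvd_natCard _ haC
      have h930 := class_mul_centralizer g
      have hle := class_le_card_comm g
      rw [hG] at h930
      rw [hn] at hle
      obtain ⟨k, hk⟩ := h3
      rw [hk] at h930
      have h310 : Nat.card (ConjClasses.mk g).carrier * k = 310 := by nlinarith
      by_contra! hlt
      have hk5 : k < 5 := by nlinarith
      have hk3 : 3 < k := by nlinarith
      obtain rfl : k = 4 := by omega
      omega
    rw [hF] at this
    omega
  have hfin : 13 ≤ ∑ q ∈ univ.erase 1, N q := by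
    have h1 : ∑ q ∈ (univ : Finset (Abelianization G)).erase 1, (1 + if q ∈ Q then 1 else 0)
        ≤ ∑ q ∈ univ.erase 1, N q := by
      apply Finset.sum_le_sum
      intro q _
      split_ifs with h
      · exact hNQ q h
      · exact hN1 q
    rw [Finset.sum_add_distrib, Finset.sum_const, Finset.card_erase_of_mem (mem_univ _), hmc,
      ← Finset.card_filter] at h1
    have h2 : Q.erase 1 ⊆ (univ.erase 1).filter (fun q => q ∈ Q) := by
      intro q hq
      simp only [mem_erase, mem_filter, mem_univ] at hq ⊢
      tauto
    have h3 := Finset.card_le_card h2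
    have h4 := Finset.pred_card_le_card_erase (s := Q) (a := 1)
    simp only [smul_eq_mul] at h1
    omega
  omega

/-- The unit `29` of order `10` modulo `93`. -/
def u29 : (ZMod 93)ˣ := ⟨29, 77, by decide, by decide⟩

/-- The group of affine maps `t ↦ x * t + a` of `ZMod 93` with `x` a power of `29`. -/
structure Aff where
  a : ZMod 93
  x : Subgroup.zpowers u29

namespace Aff

@[ext] lemma ext' {g h : Aff} (h1 : g.a = h.a) (h2 : g.x = h.x) : g = h := by
  cases g; cases h; simp_all

instance : Mul Aff := ⟨fun g h => ⟨g.a + (g.x : (ZMod 93)ˣ) * h.a, g.x * h.x⟩⟩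
instance : One Aff := ⟨⟨0, 1⟩⟩
instance : Inv Aff := ⟨fun g => ⟨-(((g.x⁻¹ : Subgroup.zpowers u29) : (ZMod 93)ˣ) * g.a), g.x⁻¹⟩⟩

@[simp] lemma mul_a (g h : Aff) : (g * h).a = g.a + (g.x : (ZMod 93)ˣ) * h.a := rfl
@[simp] lemma mul_x (g h : Aff) : (g * h).x = g.x * h.x := rfl
@[simp] lemma one_a : (1 : Aff).a = 0 := rfl
@[simp] lemma one_x : (1 : Aff).x = 1 := rfl
@[simp] lemma inv_a (g : Aff) : (g⁻¹).a = -(((g.x⁻¹ : Subgroup.zpowers u29) : (ZMod 93)ˣ) * g.a) :=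
  rfl
@[simp] lemma inv_x (g : Aff) : (g⁻¹).x = g.x⁻¹ := rfl

instance : Group Aff := Group.ofLeftAxioms
  (fun g h k => by ext1 <;> simp [mul_assoc, mul_add, add_assoc])
  (fun g => by ext1 <;> simp)
  (fun g => by ext1 <;> simp)

/-- The underlying product. -/
def equiv : Aff ≃ ZMod 93 × Subgroup.zpowers u29 where
  toFun g := (g.a, g.x)
  invFun p := ⟨p.1, p.2⟩
  left_inv _ := rfl
  right_inv _ := rfl

instance : Finite Aff := Finite.of_equiv _ equiv.symm

lemma order : orderOf u29 = 10 := by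
  rw [orderOf_eq_iff (by norm_num)]
  refine ⟨by decide, ?_⟩
  intro m hm hm0
  interval_cases m <;> decide

lemma card : Nat.card Aff = 930 := by
  rw [Nat.card_congr equiv, Nat.card_prod, Nat.card_zpowers, order, Nat.card_zmod]

/-- `29 ^ i` in the subgroup. -/
def w (i : ℕ) : Subgroup.zpowers u29 := ⟨u29 ^ i, Subgroup.npow_mem_zpowers _ _⟩

lemma exists_w (x : Subgroup.zpowers u29) : ∃ i < 10, x = w i := by
  obtain ⟨x, hx⟩ := x
  rw [mem_zpowers_iff_mem_range_orderOf, order, Finset.mem_image] at hx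
  obtain ⟨i, hi, rfl⟩ := hx
  exact ⟨i, Finset.mem_range.1 hi, rfl⟩

lemma conj_of (a b c : ZMod 93) (i j : ℕ)
    (h : 29 ^ j * a + b = c + 29 ^ i * b) :
    ConjClasses.mk (⟨a, w i⟩ : Aff) = ConjClasses.mk ⟨c, w i⟩ := by
  rw [ConjClasses.mk_eq_mk_iff_isConj, isConj_iff]
  refine ⟨⟨b, w j⟩, ?_⟩
  rw [mul_inv_eq_iff_eq_mul]
  have hw : ∀ k, (((w k : Subgroup.zpowers u29) : (ZMod 93)ˣ) : ZMod 93) = 29 ^ k := by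
    intro k; simp [w, u29]
  ext1
  · simp only [mul_a, hw]
    linear_combination h
  · simp [mul_comm]

/-- First coordinates of the chosen representatives above `29 ^ i`. -/
def reps : ℕ → List (ZMod 93)
  | 0 => [0, 31, 1, 2, 3, 5, 7, 9, 10, 14, 15]
  | i + 1 => if i % 2 = 0 then [0] else [0, 31]

/-- Indices of the representatives. -/
def pairs : List (ZMod 93 × ℕ) := (List.range 10).flatMap fun i => (reps i).map fun c => (c, i)

lemma reps_zero : ∀ a : ZMod 93, ∃ c ∈ reps 0, ∃ j < 10, 29 ^ j * a = c := by
  decide +kernel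

lemma reps_succ : ∀ i < 10, i ≠ 0 → ∀ a : ZMod 93, ∃ c ∈ reps i, ∃ j ∈ [0, 5], ∃ b : ZMod 93,
    29 ^ j * a + b = c + 29 ^ i * b := by
  decide +kernel

lemma card_classes_le : Nat.card (ConjClasses Aff) ≤ 24 := by
  classical
  let f : Fin 24 → ConjClasses Aff := fun k =>
    let p := pairs.getD k (0, 0)
    ConjClasses.mk ⟨p.1, w p.2⟩
  have hlen : pairs.length = 24 := by decide +kernel
  have hf : Function.Surjective f := by
    intro y
    obtain ⟨⟨a, x⟩, rfl⟩ := ConjClasses.exists_rep y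
    obtain ⟨i, hi, rfl⟩ := exists_w x
    have key : ∃ c ∈ reps i, ConjClasses.mk (⟨a, w i⟩ : Aff) = ConjClasses.mk ⟨c, w i⟩ := by
      by_cases h0 : i = 0
      · subst h0
        obtain ⟨c, hc, j, _, h⟩ := reps_zero a
        exact ⟨c, hc, conj_of a 0 c 0 j (by simpa using h)⟩
      · obtain ⟨c, hc, j, _, b, h⟩ := reps_succ i hi h0 a
        exact ⟨c, hc, conj_of a b c i j h⟩
    obtain ⟨c, hc, h⟩ := key
    have hmem : (c, i) ∈ pairs := by
      simp only [pairs, List.mem_flatMap, List.mem_range, List.mem_map]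
      exact ⟨i, hi, c, hc, rfl⟩
    obtain ⟨k, hk, hk'⟩ := List.getElem_of_mem hmem
    refine ⟨⟨k, hlen ▸ hk⟩, ?_⟩
    simp only [f]
    rw [List.getD_eq_getElem _ _ hk, hk', h]
  simpa using Nat.card_le_card_of_surjective f hf

end Aff

/-- **Groups of order 930.**
The smallest number of conjugacy classes of a finite group of order `930 = 2·3·5·31` is
`24`: every group of order `930` has at least `24` conjugacy classes and some group of
order `930` has exactly `24` conjugacy classes. -/
theorem classNumber_order_930 :
    (∀ (G : Type) [Group G] [Finite G],
        Nat.card G = 930 → 24 ≤ Nat.card (ConjClasses G)) ∧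
    (∃ (G : Type) (_ : Group G) (_ : Finite G),
        Nat.card G = 930 ∧ Nat.card (ConjClasses G) = 24) := by
  refine ⟨fun G _ _ h => lower_bound G h, Aff, inferInstance, inferInstance, Aff.card, ?_⟩
  exact le_antisymm Aff.card_classes_le (lower_bound Aff Aff.card)
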